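/- Given pastures P₁, P₂ and morphisms of pastures f, g : P₁ → P₂, the coequalizer Q = {0} ∪ (P₂^×/∼) with the quotient map q : P₂ → Q satisfies the universal property of the coequalizer: if Q' is a pasture and q' : P₂ → Q' is a morphism of pastures with q' ∘ f = q' ∘ g, then there is a unique morphism of pastures u : Q → Q' with u ∘ q = q'; explicitly, u([x]) = q'(x). -/

import Mathlib

universe u v w

/-- A pasture structure on a type `P`: a multiplication, a zero, a one,
an involution `neg`, and a ternary nullset relation `null a b c`
(meaning "`a + b + c = 0`"). -/
structure PastureStr (P : Type u) where
  mul : P → P → P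
  zero : P
  one : P
  neg : P → P
  null : P → P → P → Prop

/-- `P` together with a `PastureStr` is a pasture: `P` is a commutative
monoid with zero whose nonzero elements form an abelian group, `neg` is an
involution fixing `0`, and the nullset is invariant under permutations,
invariant under multiplication, and satisfies `a + b + 0 = 0 ↔ a = -b`. -/
structure PastureStr.IsPasture {P : Type u} (S : PastureStr P) : Prop where
  mul_comm : ∀ a b : P, S.mul a b = S.mul b a
  mul_assoc : ∀ a b c : P, S.mul (S.mul a b) c = S.mul a (S.mul b c)
  one_mul : ∀ a : P, S.mul S.one a = a
  zero_mul : ∀ a : P, S.mul S.zero a = S.zero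
  one_ne_zero : S.one ≠ S.zero
  mul_ne_zero : ∀ a b : P, a ≠ S.zero → b ≠ S.zero → S.mul a b ≠ S.zero
  exists_inv : ∀ a : P, a ≠ S.zero → ∃ b : P, S.mul a b = S.one
  neg_neg : ∀ a : P, S.neg (S.neg a) = a
  neg_zero : S.neg S.zero = S.zero
  null_swap_left : ∀ a b c : P, S.null a b c → S.null b a c
  null_swap_right : ∀ a b c : P, S.null a b c → S.null a c b
  null_mul : ∀ d a b c : P, S.null a b c → S.null (S.mul d a) (S.mul d b) (S.mul d c)
  null_zero : ∀ a b : P, S.null a b S.zero ↔ a = S.neg b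

/-- A morphism of pastures: a multiplicative map preserving `0`, `1`,
the involution and the nullset. -/
structure PastureStr.IsHom {P : Type u} {P' : Type v} (S : PastureStr P) (T : PastureStr P')
    (f : P → P') : Prop where
  map_mul : ∀ a b : P, f (S.mul a b) = T.mul (f a) (f b)
  map_zero : f S.zero = T.zero
  map_one : f S.one = T.one
  map_neg : ∀ a : P, f (S.neg a) = T.neg (f a)
  map_null : ∀ a b c : P, S.null a b c → T.null (f a) (f b) (f c)

variable {P₁ P₂ : Type u}

/-- The relation on `P₂^×` defining the coequalizer of `f, g : P₁ → P₂`: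
`x ∼ y` iff `x y⁻¹ = f(z) g(z)⁻¹` for some `z ∈ P₁^×` (expressed here as
`x · g(z) = f(z) · y`). -/
def coeqRel (S₁ : PastureStr P₁) (S₂ : PastureStr P₂) (f g : P₁ → P₂) :
    {x : P₂ // x ≠ S₂.zero} → {x : P₂ // x ≠ S₂.zero} → Prop := fun x y =>
  ∃ z : P₁, z ≠ S₁.zero ∧ S₂.mul x.1 (g z) = S₂.mul (f z) y.1

/-- The underlying set of the coequalizer of `f, g : P₁ → P₂`:
`{0} ∪ (P₂^× / ∼)`, with `none` playing the role of `0`. -/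
def CoeqCarrier (S₁ : PastureStr P₁) (S₂ : PastureStr P₂) (f g : P₁ → P₂) :
    Type u :=
  Option (Quot (coeqRel S₁ S₂ f g))

open Classical in
/-- The quotient map `q : P₂ → Q = {0} ∪ (P₂^× / ∼)`, sending `0` to `0` and
a nonzero `x` to its class `[x]`. -/
noncomputable def coeqMap (S₁ : PastureStr P₁) (S₂ : PastureStr P₂)
    (f g : P₁ → P₂) : P₂ → CoeqCarrier S₁ S₂ f g := fun x =>
  if h : x = S₂.zero then none else some (Quot.mk (coeqRel S₁ S₂ f g) ⟨x, h⟩)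

/-- A pasture structure `SQ` on `Q = {0} ∪ (P₂^× / ∼)` realizes the
coequalizer if: its zero is `0`, its one is `[1]`, its multiplication
satisfies `[x] · [y] = [xy]` (in particular multiplication of classes is
well-defined), its involution satisfies `-[x] = [-x]` (in particular it is
well-defined), and its nullset consists of the triples `([a],[b],[c])` such
that some representatives satisfy `a' + b' + c' = 0` in `P₂`. -/
def CoeqSpec (S₁ : PastureStr P₁) (S₂ : PastureStr P₂) (f g : P₁ → P₂)
    (SQ : PastureStr (CoeqCarrier S₁ S₂ f g)) : Prop :=
  SQ.zero = none ∧
  SQ.one = coeqMap S₁ S₂ f g S₂.one ∧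
  (∀ x y : P₂, SQ.mul (coeqMap S₁ S₂ f g x) (coeqMap S₁ S₂ f g y) =
      coeqMap S₁ S₂ f g (S₂.mul x y)) ∧
  (∀ x : P₂, SQ.neg (coeqMap S₁ S₂ f g x) = coeqMap S₁ S₂ f g (S₂.neg x)) ∧
  (∀ u v w : CoeqCarrier S₁ S₂ f g, SQ.null u v w ↔
      ∃ a b c : P₂, S₂.null a b c ∧
        coeqMap S₁ S₂ f g a = u ∧ coeqMap S₁ S₂ f g b = v ∧
        coeqMap S₁ S₂ f g c = w)

/-- A morphism of pastures with the same composites with `f` and `g` identifies related units. -/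
theorem PastureStr.IsHom.map_eq_of_coeqRel {Q' : Type v} {S₁ : PastureStr P₁} {S₂ : PastureStr P₂}
    {S' : PastureStr Q'} {f g : P₁ → P₂} {q' : P₂ → Q'} (hS₁ : S₁.IsPasture)
    (hS' : S'.IsPasture) (hf : S₁.IsHom S₂ f) (hq' : S₂.IsHom S' q') (hfg : q' ∘ f = q' ∘ g)
    {x y : {x : P₂ // x ≠ S₂.zero}} (h : coeqRel S₁ S₂ f g x y) : q' x.1 = q' y.1 := by
  obtain ⟨z, hz, hxy⟩ := h
  obtain ⟨w, hw⟩ := hS₁.exists_inv z hz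
  have hinv : S'.mul (q' (f z)) (q' (f w)) = S'.one := by
    rw [← hq'.map_mul, ← hf.map_mul, hw, hf.map_one, hq'.map_one]
  have hmul : S'.mul (q' (f z)) (q' x.1) = S'.mul (q' (f z)) (q' y.1) := by
    have hz' : q' (f z) = q' (g z) := congrFun hfg z
    rw [hS'.mul_comm, hz', ← hq'.map_mul, hxy, hq'.map_mul, hz']
  have cancel (a : Q') : S'.mul (q' (f w)) (S'.mul (q' (f z)) a) = a := by
    rw [← hS'.mul_assoc, hS'.mul_comm (q' (f w)), hinv, hS'.one_mul]
  rw [← cancel (q' x.1), hmul, cancel]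

theorem coeqMap_zero (S₁ : PastureStr P₁) (S₂ : PastureStr P₂) (f g : P₁ → P₂) :
    coeqMap S₁ S₂ f g S₂.zero = none :=
  dif_pos rfl

theorem coeqMap_of_ne_zero {S₁ : PastureStr P₁} {S₂ : PastureStr P₂} {f g : P₁ → P₂} {x : P₂}
    (hx : x ≠ S₂.zero) :
    coeqMap S₁ S₂ f g x = some (Quot.mk (coeqRel S₁ S₂ f g) ⟨x, hx⟩) :=
  dif_neg hx

theorem coeqMap_surjective (S₁ : PastureStr P₁) (S₂ : PastureStr P₂) (f g : P₁ → P₂) :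
    Function.Surjective (coeqMap S₁ S₂ f g) := by
  rintro (_ | ⟨x, hx⟩)
  · exact ⟨S₂.zero, coeqMap_zero S₁ S₂ f g⟩
  · exact ⟨x, coeqMap_of_ne_zero hx⟩

/-- A map out of `P₂` that respects `coeqRel` factors through `coeqMap`. -/
theorem exists_comp_coeqMap_eq {Q' : Type v} {S₁ : PastureStr P₁} {S₂ : PastureStr P₂}
    {f g : P₁ → P₂} {q' : P₂ → Q'}
    (h : ∀ x y, coeqRel S₁ S₂ f g x y → q' x.1 = q' y.1) :
    ∃ u : CoeqCarrier S₁ S₂ f g → Q', ∀ x, u (coeqMap S₁ S₂ f g x) = q' x := by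
  refine ⟨fun c => Option.elim c (q' S₂.zero) (Quot.lift (fun x => q' x.1) h), fun x => ?_⟩
  by_cases hx : x = S₂.zero
  · subst hx
    rw [coeqMap_zero]
    rfl
  · rw [coeqMap_of_ne_zero hx]
    rfl

/-- A factorization of a morphism through `coeqMap` is itself a morphism. -/
theorem CoeqSpec.isHom_of_comp_eq {Q' : Type v} {S₁ : PastureStr P₁} {S₂ : PastureStr P₂}
    {S' : PastureStr Q'} {f g : P₁ → P₂} {SQ : PastureStr (CoeqCarrier S₁ S₂ f g)} {q' : P₂ → Q'}
    {u : CoeqCarrier S₁ S₂ f g → Q'} (hSQ : CoeqSpec S₁ S₂ f g SQ) (hq' : S₂.IsHom S' q')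
    (hu : ∀ x, u (coeqMap S₁ S₂ f g x) = q' x) : SQ.IsHom S' u := by
  obtain ⟨h0, h1, hmul, hneg, hnull⟩ := hSQ
  have hsurj := coeqMap_surjective S₁ S₂ f g
  constructor
  · intro a b
    obtain ⟨x, rfl⟩ := hsurj a
    obtain ⟨y, rfl⟩ := hsurj b
    rw [hmul, hu, hu, hu, hq'.map_mul]
  · rw [h0, ← coeqMap_zero S₁ S₂ f g, hu, hq'.map_zero]
  · rw [h1, hu, hq'.map_one]
  · intro a
    obtain ⟨x, rfl⟩ := hsurj a
    rw [hneg, hu, hu, hq'.map_neg]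
  · intro a b c h
    obtain ⟨x, y, z, hxyz, rfl, rfl, rfl⟩ := (hnull a b c).1 h
    rw [hu, hu, hu]
    exact hq'.map_null x y z hxyz

/-- **The coequalizer of two morphisms of pastures satisfies the universal
property of the coequalizer**: for any pasture structure realizing the
coequalizer `Q` and any pasture `Q'` with a morphism `q' : P₂ → Q'` such that
`q' ∘ f = q' ∘ g`, there is a unique morphism `u : Q → Q'` with `u ∘ q = q'`;
explicitly, `u [x] = q' x`. -/
theorem coequalizer_universal_property
    (S₁ : PastureStr P₁) (S₂ : PastureStr P₂)
    (hS₁ : S₁.IsPasture) (hS₂ : S₂.IsPasture)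
    (f g : P₁ → P₂) (hf : S₁.IsHom S₂ f) (hg : S₁.IsHom S₂ g)
    (SQ : PastureStr (CoeqCarrier S₁ S₂ f g))
    (hSQ : CoeqSpec S₁ S₂ f g SQ) (hSQP : SQ.IsPasture)
    (Q' : Type v) (S' : PastureStr Q') (hS' : S'.IsPasture)
    (q' : P₂ → Q') (hq' : S₂.IsHom S' q') (hfg : q' ∘ f = q' ∘ g) :
    ∃ u : CoeqCarrier S₁ S₂ f g → Q',
      (PastureStr.IsHom SQ S' u ∧ u ∘ coeqMap S₁ S₂ f g = q' ∧
        ∀ (x : P₂) (hx : x ≠ S₂.zero),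
          u (some (Quot.mk (coeqRel S₁ S₂ f g) ⟨x, hx⟩)) = q' x) ∧
      ∀ u' : CoeqCarrier S₁ S₂ f g → Q',
        (PastureStr.IsHom SQ S' u' ∧ u' ∘ coeqMap S₁ S₂ f g = q') → u' = u := by
  obtain ⟨u, hu⟩ := exists_comp_coeqMap_eq fun _ _ h =>
    hf.map_eq_of_coeqRel hS₁ hS' hq' hfg h
  refine ⟨u, ⟨hSQ.isHom_of_comp_eq hq' hu, funext hu, fun x hx => ?_⟩, ?_⟩
  · rw [← coeqMap_of_ne_zero hx, hu]
  · rintro u' ⟨-, hu'⟩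
    exact (coeqMap_surjective S₁ S₂ f g).injective_comp_right (hu'.trans (funext hu).symm)
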